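/- arXiv:cs/0405076 — 2 statements merged into one kernel-verified Lean document; each statement's English description precedes it below -/
import Mathlib

section
/- Let P be a program, V the set of variable rules in the language of P, and G a ground literal. Then (P \ F) ∪ E accomplishes a view update for the deletion of G if and only if (E, F) is a minimal credulous anti-explanation of the negative observation G with respect to the abductive program ⟨P, V⟩. -/
namespace ASP

/-- A ground literal: an atom or its explicit (classical) negation. -/
inductive Lit (α : Type) where
  | pos : α → Lit α
  | neg : α → Lit α

/-- The complement ¬L of a literal L. -/
def Lit.compl {α : Type} : Lit α → Lit α
  | .pos a => .neg a
  | .neg a => .pos a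

/-- The atom of a literal. -/
def Lit.atom {α : Type} : Lit α → α
  | .pos a => a
  | .neg a => a

/-- Map a literal along a function on atoms. -/
def Lit.map {α β : Type} (f : α → β) : Lit α → Lit β
  | .pos a => .pos (f a)
  | .neg a => .neg (f a)

/-- A ground rule  Σ ← Γ, not Δ  with head Σ, positive body Γ, negative body Δ. -/
structure Rule (α : Type) where
  head : Finset (Lit α)
  pbody : Finset (Lit α)
  nbody : Finset (Lit α)

/-- An extended disjunctive program: a set of ground rules. -/
abbrev Program (α : Type) := Set (Rule α)

/-- Map a rule along a function on atoms. -/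
noncomputable def Rule.map {α β : Type} (f : α → β) (r : Rule α) : Rule β :=
  letI := Classical.decEq (Lit β)
  ⟨r.head.image (Lit.map f), r.pbody.image (Lit.map f), r.nbody.image (Lit.map f)⟩

/-- The set of atoms occurring in a rule. -/
def Rule.atoms {α : Type} (r : Rule α) : Set α :=
  Lit.atom '' ((↑r.head : Set (Lit α)) ∪ (↑r.pbody : Set (Lit α)) ∪ (↑r.nbody : Set (Lit α)))

/-- S satisfies the rule Σ ← Γ, not Δ : if Γ ⊆ S and Δ ∩ S = ∅ then Σ ∩ S ≠ ∅. -/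
def Rule.sat {α : Type} (S : Set (Lit α)) (r : Rule α) : Prop :=
  ((↑r.pbody : Set (Lit α)) ⊆ S ∧ ∀ l ∈ r.nbody, l ∉ S) → ∃ l ∈ r.head, l ∈ S

/-- The two closure conditions on candidate answer sets of a not-free program:
S satisfies every rule, and if S contains a complementary pair then S is the
set of all literals of the language. -/
def okNF {α : Type} (P : Program α) (S : Set (Lit α)) : Prop :=
  (∀ r ∈ P, r.sat S) ∧ ((∃ l : Lit α, l ∈ S ∧ l.compl ∈ S) → S = Set.univ)

/-- Answer set of a not-free program: a minimal set satisfying the conditions. -/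
def AnswerSetNF {α : Type} (P : Program α) (S : Set (Lit α)) : Prop :=
  okNF P S ∧ ∀ T, T ⊆ S → okNF P T → T = S

/-- The reduct P^S of a program P with respect to S. -/
def reduct {α : Type} (P : Program α) (S : Set (Lit α)) : Program α :=
  { r' | ∃ r ∈ P, (∀ l ∈ r.nbody, l ∉ S) ∧ r' = ⟨r.head, r.pbody, (∅ : Finset (Lit α))⟩ }

/-- S is an answer set of P if S is an answer set of the reduct P^S. -/
def AnswerSet {α : Type} (P : Program α) (S : Set (Lit α)) : Prop :=
  AnswerSetNF (reduct P S) S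

/-- S is a consistent answer set of P. -/
def ConsAS {α : Type} (P : Program α) (S : Set (Lit α)) : Prop :=
  AnswerSet P S ∧ S ≠ Set.univ

/-- P is consistent: it has a consistent answer set. -/
def Consistent {α : Type} (P : Program α) : Prop := ∃ S, ConsAS P S

/-- P ⊨ G : G belongs to every answer set of P. -/
def Entails {α : Type} (P : Program α) (G : Lit α) : Prop :=
  ∀ S, AnswerSet P S → G ∈ S

/-- The fact L ← . -/
def factOf {α : Type} (l : Lit α) : Rule α := ⟨{l}, ∅, ∅⟩

/-- A set of literals viewed as a program of facts. -/
def facts {α : Type} (A : Set (Lit α)) : Program α := factOf '' A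

/-- The updated program (P \ F) ∪ E. -/
def upd {α : Type} (P E F : Program α) : Program α := (P \ F) ∪ E

/-- Hypothesis condition for (anti-)explanations: E ⊆ A \ P and F ⊆ A ∩ P. -/
def Hyp {α : Type} (P A E F : Program α) : Prop := E ⊆ A \ P ∧ F ⊆ A ∩ P

/-- (E,F) is a credulous explanation of the positive observation G w.r.t. ⟨P,A⟩. -/
def CredExpl {α : Type} (P A : Program α) (G : Lit α) (E F : Program α) : Prop :=
  Hyp P A E F ∧ ∃ S, ConsAS (upd P E F) S ∧ G ∈ S

/-- (E,F) is a skeptical explanation of the positive observation G w.r.t. ⟨P,A⟩. -/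
def SkepExpl {α : Type} (P A : Program α) (G : Lit α) (E F : Program α) : Prop :=
  Hyp P A E F ∧ Consistent (upd P E F) ∧ Entails (upd P E F) G

/-- (E,F) is a credulous anti-explanation of the negative observation G w.r.t. ⟨P,A⟩. -/
def CredAntiExpl {α : Type} (P A : Program α) (G : Lit α) (E F : Program α) : Prop :=
  Hyp P A E F ∧ Consistent (upd P E F) ∧ ¬ Entails (upd P E F) G

/-- (E,F) is a skeptical anti-explanation of the negative observation G w.r.t. ⟨P,A⟩. -/
def SkepAntiExpl {α : Type} (P A : Program α) (G : Lit α) (E F : Program α) : Prop :=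
  Hyp P A E F ∧ Consistent (upd P E F) ∧ ∀ S, AnswerSet (upd P E F) S → G ∉ S

/-- (E,F) is a credulous anti-explanation of the negative observation ⊥ w.r.t. ⟨P,A⟩:
(P \ F) ∪ E is consistent. -/
def CredAntiExplBot {α : Type} (P A : Program α) (E F : Program α) : Prop :=
  Hyp P A E F ∧ Consistent (upd P E F)

/-- (E,F) is a minimal pair among those satisfying X. -/
def MinimalPair {α : Type} (X : Program α → Program α → Prop) (E F : Program α) : Prop :=
  X E F ∧ ∀ E' F', X E' F' → E' ⊆ E → F' ⊆ F → (E' = E ∧ F' = F)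

/-- Standing assumption on abductive programs: any rule of P whose head contains
an abducible has all its head literals abducible and an empty body. -/
def AbdAssum1 {α : Type} (P A : Program α) : Prop :=
  ∀ r ∈ P, (∃ l ∈ r.head, factOf l ∈ A) →
    ((∀ l ∈ r.head, factOf l ∈ A) ∧ r.pbody = ∅ ∧ r.nbody = ∅)

/-- Standing assumption on abductive programs: any (disjunctive) fact of P all of
whose disjuncts are abducibles itself belongs to A. -/
def AbdAssum2 {α : Type} (P A : Program α) : Prop :=
  ∀ r ∈ P, r.head ≠ ∅ → r.pbody = ∅ → r.nbody = ∅ →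
    (∀ l ∈ r.head, factOf l ∈ A) → r ∈ A

/-- Atoms of the update program: base atoms, the fresh atoms ā, +a, −a for abducibles a. -/
inductive UAtom (α : Type) where
  | base : α → UAtom α
  | abar : Lit α → UAtom α
  | aplus : Lit α → UAtom α
  | aminus : Lit α → UAtom α

/-- Embedding of literals over α into literals over UAtom α. -/
def emb {α : Type} : Lit α → Lit (UAtom α) := Lit.map UAtom.base

/-- The update program UP of an abductive program ⟨P, A⟩ with abducible facts A. -/
noncomputable def UP {α : Type} (P : Program α) (A : Set (Lit α)) : Program (UAtom α) :=
  (Rule.map UAtom.base '' (P \ facts A)) ∪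
  { r | ∃ a ∈ A, r = ⟨{emb a}, ∅, {Lit.pos (UAtom.abar a)}⟩ ∨
                 r = ⟨{Lit.pos (UAtom.abar a)}, ∅, {emb a}⟩ } ∪
  { r | ∃ a ∈ A, factOf a ∉ P ∧ r = ⟨{Lit.pos (UAtom.aplus a)}, {emb a}, ∅⟩ } ∪
  { r | ∃ a ∈ A, factOf a ∈ P ∧ r = ⟨{Lit.pos (UAtom.aminus a)}, ∅, {emb a}⟩ }

/-- E⁺ = { +a | a ∈ E }. -/
def pSet {α : Type} (E : Set (Lit α)) : Set (Lit (UAtom α)) :=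
  { l | ∃ a ∈ E, l = Lit.pos (UAtom.aplus a) }

/-- F⁻ = { −a | a ∈ F }. -/
def mSet {α : Type} (F : Set (Lit α)) : Set (Lit (UAtom α)) :=
  { l | ∃ a ∈ F, l = Lit.pos (UAtom.aminus a) }

/-- UA : the set of all update atoms for abducibles A. -/
def UAall {α : Type} (A : Set (Lit α)) : Set (Lit (UAtom α)) := pSet A ∪ mSet A

/-- S is a U-minimal answer set of Q (w.r.t. the update atoms UAs). -/
def UMin {β : Type} (Q : Program β) (UAs : Set (Lit β)) (S : Set (Lit β)) : Prop :=
  AnswerSet Q S ∧ ¬ ∃ T, AnswerSet Q T ∧ T ∩ UAs ⊂ S ∩ UAs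

/-- The constraint ← not G. -/
def notCon {α : Type} (G : Lit α) : Rule α := ⟨∅, ∅, {G}⟩

/-- The constraint ← G. -/
def posCon {α : Type} (G : Lit α) : Rule α := ⟨∅, {G}, ∅⟩

/-- r is a non-disjunctive fact  L ← . -/
def isNDFact {α : Type} (r : Rule α) : Prop :=
  (∃ l, r.head = {l}) ∧ r.pbody = ∅ ∧ r.nbody = ∅

/-- R : the abducibles of A that are not non-disjunctive facts. -/
def Rset {α : Type} (A : Program α) : Program α := { r ∈ A | ¬ isNDFact r }

/-- Σ ← Γ, not Δ, γ_R : the rule R with its name γ_R added to the positive body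
(over the atom type α ⊕ Rule α, the name of R being Sum.inr R). -/
noncomputable def addName {α : Type} (r : Rule α) : Rule (α ⊕ Rule α) :=
  letI := Classical.decEq (Lit (α ⊕ Rule α))
  ⟨(Rule.map Sum.inl r).head,
   insert (Lit.pos (Sum.inr r)) (Rule.map Sum.inl r).pbody,
   (Rule.map Sum.inl r).nbody⟩

/-- Pⁿ of the normal form ⟨Pⁿ, Aⁿ⟩ of an abductive program ⟨P, A⟩. -/
noncomputable def Pn {α : Type} (P A : Program α) : Program (α ⊕ Rule α) :=
  (Rule.map Sum.inl '' (P \ Rset A)) ∪ (addName '' Rset A) ∪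
  (facts { l | ∃ r ∈ Rset A ∩ P, l = Lit.pos (Sum.inr r) })

/-- Aⁿ of the normal form ⟨Pⁿ, Aⁿ⟩, as a set of abducible facts (literals). -/
def An {α : Type} (A : Program α) : Set (Lit (α ⊕ Rule α)) :=
  { l | ∃ r ∈ A, isNDFact r ∧ ∃ l₀, r.head = {l₀} ∧ l = Lit.map Sum.inl l₀ } ∪
  { l | ∃ r ∈ Rset A, l = Lit.pos (Sum.inr r) }

/-- The name n(R) of an abducible rule R: itself (embedded) if R is a
non-disjunctive fact, and the fresh atom γ_R otherwise. -/
noncomputable def nLit {α : Type} (r : Rule α) : Lit (α ⊕ Rule α) :=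
  letI := Classical.dec (isNDFact r)
  if h : isNDFact r then Lit.map Sum.inl h.1.choose else Lit.pos (Sum.inr r)

/-- n(E) = { n(R) | R ∈ E }. -/
noncomputable def nSet {α : Type} (E : Program α) : Set (Lit (α ⊕ Rule α)) := nLit '' E

/-- P' accomplishes a view update for the insertion of G (variable rules V). -/
def ViewInsert {α : Type} (P V : Program α) (G : Lit α) (P' : Program α) : Prop :=
  Consistent P' ∧ Entails P' G ∧ P' \ V = P \ V ∧
  ¬ ∃ P'' : Program α, Consistent P'' ∧ Entails P'' G ∧ P'' \ V = P \ V ∧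
      symmDiff (P ∩ V) (P'' ∩ V) ⊂ symmDiff (P ∩ V) (P' ∩ V)

/-- P' accomplishes a view update for the deletion of G (variable rules V). -/
def ViewDelete {α : Type} (P V : Program α) (G : Lit α) (P' : Program α) : Prop :=
  Consistent P' ∧ ¬ Entails P' G ∧ P' \ V = P \ V ∧
  ¬ ∃ P'' : Program α, Consistent P'' ∧ ¬ Entails P'' G ∧ P'' \ V = P \ V ∧
      symmDiff (P ∩ V) (P'' ∩ V) ⊂ symmDiff (P ∩ V) (P' ∩ V)

/-- P' restores consistency (w.r.t. the integrity constraints, variable rules V). -/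
def Restores {α : Type} (P V : Program α) (P' : Program α) : Prop :=
  Consistent P' ∧ P' \ V = P \ V ∧
  ¬ ∃ P'' : Program α, Consistent P'' ∧ P'' \ V = P \ V ∧
      symmDiff (P ∩ V) (P'' ∩ V) ⊂ symmDiff (P ∩ V) (P' ∩ V)

/-- P' accomplishes a theory update of P by Q. -/
def TheoryUpdate {α : Type} (P Q P' : Program α) : Prop :=
  Consistent P' ∧ Q ⊆ P' ∧ P' ⊆ P ∪ Q ∧
  ¬ ∃ P'' : Program α, Consistent P'' ∧ P' ⊂ P'' ∧ P'' ⊆ P ∪ Q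

/-- P' accomplishes the insertion of the rule R to P. -/
def InsertRule {α : Type} (P : Program α) (R : Rule α) (P' : Program α) : Prop :=
  Consistent P' ∧ R ∈ P' ∧ P' ⊆ P ∪ {R} ∧
  ¬ ∃ P'' : Program α, Consistent P'' ∧ P' ⊂ P'' ∧ P'' ⊆ P ∪ {R}

/-- P' accomplishes the deletion of the rule R from P. -/
def DeleteRule {α : Type} (P : Program α) (R : Rule α) (P' : Program α) : Prop :=
  Consistent P' ∧ P' ⊆ P \ {R} ∧
  ¬ ∃ P'' : Program α, Consistent P'' ∧ P' ⊂ P'' ∧ P'' ⊆ P \ {R}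

/-- P' accomplishes an inconsistency removal of P. -/
def InconsRemoval {α : Type} (P P' : Program α) : Prop :=
  Consistent P' ∧ P' ⊆ P ∧
  ¬ ∃ P'' : Program α, Consistent P'' ∧ P' ⊂ P'' ∧ P'' ⊆ P


theorem upd_diff_of_hyp {α : Type} {P V E F : Program α} (h : Hyp P V E F) :
    upd P E F \ V = P \ V := by
  ext r
  have hE := @h.1 r
  have hF := @h.2 r
  simp only [upd, Set.mem_sdiff, Set.mem_union, Set.mem_inter_iff] at *
  tauto

theorem symmDiff_upd_of_hyp {α : Type} {P V E F : Program α} (h : Hyp P V E F) :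
    symmDiff (P ∩ V) (upd P E F ∩ V) = E ∪ F := by
  ext r
  have hE := @h.1 r
  have hF := @h.2 r
  simp only [upd, Set.mem_symmDiff, Set.mem_sdiff, Set.mem_union, Set.mem_inter_iff] at *
  tauto

theorem hyp_of_diff_eq {α : Type} {P V Q : Program α} (h : Q \ V = P \ V) :
    Hyp P V (Q \ P) (P \ Q) := by
  constructor <;> intro r hr <;> have hV := Set.ext_iff.mp h r <;>
    simp only [Set.mem_sdiff, Set.mem_inter_iff] at * <;> tauto

theorem upd_diff_diff {α : Type} (P Q : Program α) : upd P (Q \ P) (P \ Q) = Q := by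
  ext r
  simp only [upd, Set.mem_sdiff, Set.mem_union]
  tauto

theorem union_subset_union_iff_of_hyp {α : Type} {P V E F E' F' : Program α}
    (h : Hyp P V E F) (h' : Hyp P V E' F') : E' ∪ F' ⊆ E ∪ F ↔ E' ⊆ E ∧ F' ⊆ F := by
  refine ⟨fun hs => ⟨fun r hr => ?_, fun r hr => ?_⟩,
    fun hs => Set.union_subset_union hs.1 hs.2⟩
  · exact (hs (Or.inl hr)).resolve_right fun hF => (h'.1 hr).2 (h.2 hF).2
  · exact (hs (Or.inr hr)).resolve_left fun hE => (h.1 hE).2 (h'.2 hr).2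

/-- Theorem 4.1, deletion part (view updates by extended abduction). -/
theorem view_deletion_by_extended_abduction {α : Type} (P V : Program α)
    (h1 : AbdAssum1 P V) (h2 : AbdAssum2 P V) (G : Lit α)
    (E F : Program α) (hE : E ⊆ V \ P) (hF : F ⊆ V ∩ P) :
    ViewDelete P V G (upd P E F) ↔ MinimalPair (CredAntiExpl P V G) E F := by
  have hyp : Hyp P V E F := ⟨hE, hF⟩
  constructor
  · rintro ⟨hc, he, -, hmin⟩
    refine ⟨⟨hyp, hc, he⟩, fun E' F' ⟨hyp', hc', he'⟩ hEE hFF => ?_⟩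
    by_contra hne
    refine hmin ⟨upd P E' F', hc', he', upd_diff_of_hyp hyp', ?_⟩
    rw [symmDiff_upd_of_hyp hyp, symmDiff_upd_of_hyp hyp']
    refine ⟨Set.union_subset_union hEE hFF, fun hsub => hne ?_⟩
    obtain ⟨hE', hF'⟩ := (union_subset_union_iff_of_hyp hyp' hyp).mp hsub
    exact ⟨hEE.antisymm hE', hFF.antisymm hF'⟩
  · rintro ⟨⟨-, hc, he⟩, hmin⟩
    refine ⟨hc, he, upd_diff_of_hyp hyp, ?_⟩
    rintro ⟨Q, hQc, hQe, hQV, hss⟩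
    have hypQ := hyp_of_diff_eq hQV
    rw [← upd_diff_diff P Q] at hQc hQe hss
    rw [symmDiff_upd_of_hyp hyp, symmDiff_upd_of_hyp hypQ] at hss
    obtain ⟨hEE, hFF⟩ := (union_subset_union_iff_of_hyp hyp hypQ).mp hss.1
    obtain ⟨h3, h4⟩ := hmin _ _ ⟨hypQ, hQc, hQe⟩ hEE hFF
    exact hss.2 (by rw [h3, h4])

end ASP
end

section
/- Let P be a program. Then a program P' accomplishes an inconsistency removal of P if and only if P' = P \ F where (∅, F) is a minimal credulous anti-explanation of the negative observation G = ⊥ with respect to the abductive program ⟨P, P⟩. -/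
namespace ASP

theorem credAntiExplBot_empty_iff {α : Type} (P F : Program α) :
    CredAntiExplBot P P ∅ F ↔ F ⊆ P ∧ Consistent (P \ F) := by
  simp [CredAntiExplBot, Hyp, upd]

/-- Theorem 5.5 (inconsistency removal by extended abduction). -/
theorem inconsistency_removal_by_extended_abduction {α : Type} (P P' : Program α) :
    InconsRemoval P P' ↔
      ∃ F : Program α, P' = P \ F ∧
        MinimalPair (CredAntiExplBot P P) ∅ F := by
  constructor
  · rintro ⟨hc, hs, hmax⟩
    have hdiff : P \ (P \ P') = P' := Set.sdiff_sdiff_cancel_left hs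
    refine ⟨P \ P', hdiff.symm, ?_, ?_⟩
    · rw [credAntiExplBot_empty_iff, hdiff]
      exact ⟨Set.sdiff_subset, hc⟩
    · intro E F hX hE hF
      obtain rfl := Set.subset_empty_iff.mp hE
      refine ⟨rfl, hF.antisymm ?_⟩
      rw [credAntiExplBot_empty_iff] at hX
      intro r hr
      by_contra hrF
      exact hmax ⟨P \ F, hX.2,
        ⟨fun x hx => ⟨hs hx, fun hxF => (hF hxF).2 hx⟩, fun h => hr.2 (h ⟨hr.1, hrF⟩)⟩,
        Set.sdiff_subset⟩
  · rintro ⟨F, rfl, hX, hmin⟩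
    rw [credAntiExplBot_empty_iff] at hX
    refine ⟨hX.2, Set.sdiff_subset, ?_⟩
    rintro ⟨Q, hQ, hlt, hQP⟩
    have hdiff : P \ (P \ Q) = Q := Set.sdiff_sdiff_cancel_left hQP
    have hF : P \ Q ⊆ F := fun r hr => by
      by_contra hrF
      exact hr.2 (hlt.1 ⟨hr.1, hrF⟩)
    have hX' : CredAntiExplBot P P ∅ (P \ Q) := by
      rw [credAntiExplBot_empty_iff, hdiff]
      exact ⟨Set.sdiff_subset, hQ⟩
    have heq := (hmin ∅ (P \ Q) hX' subset_rfl hF).2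
    exact hlt.ne (by rw [← heq, hdiff])

end ASP
end
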